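/- arXiv:1703.05242 — 11 statements merged into one kernel-verified Lean document; each statement's English description precedes it below -/
import Mathlib

section
/- Let F be a decomposition of a Hausdorff topological space X. If F is pointwise almost periodic and the class decomposition F̂ is upper semicontinuous, then F is R-closed. -/
open Set Topology

/-- The class of `x` in the decomposition `F` : the set of points whose element
has the same closure as the element of `x`. -/
def Fhat {X : Type*} [TopologicalSpace X] (F : X → Set X) (x : X) : Set X :=
  {y | closure (F y) = closure (F x)}

/-- In a pointwise almost periodic decomposition, the closure of each element is its class. -/
theorem closure_eq_Fhat {X : Type*} [TopologicalSpace X] {F : X → Set X}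
    (hmem : ∀ x, x ∈ F x)
    (hpap : ∀ x y, closure (F x) = closure (F y) ∨ Disjoint (closure (F x)) (closure (F y)))
    (x : X) : closure (F x) = Fhat F x := by
  ext y
  have hy : y ∈ closure (F y) := subset_closure (hmem y)
  constructor
  · intro hyx
    exact (hpap y x).resolve_right fun h => Set.disjoint_left.mp h hy hyx
  · intro h
    have h' : closure (F y) = closure (F x) := h
    exact h' ▸ hy

/-- If a pointwise almost periodic decomposition `F` of a Hausdorff space has upper
semicontinuous class decomposition `F̂`, then `F` is `R`-closed. -/
theorem stmt0 {X : Type*} [TopologicalSpace X] [T2Space X]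
    (F : X → Set X)
    (hmem : ∀ x, x ∈ F x)
    (hpart : ∀ x y, y ∈ F x → F y = F x)
    (hpap : ∀ x y, closure (F x) = closure (F y) ∨ Disjoint (closure (F x)) (closure (F y)))
    (husc₁ : ∀ x, IsClosed (Fhat F x) ∧ IsCompact (Fhat F x))
    (husc₂ : ∀ x, ∀ U : Set X, IsOpen U → Fhat F x ⊆ U →
      ∃ V : Set X, Fhat F x ⊆ interior V ∧ V ⊆ U ∧ ∀ y ∈ V, Fhat F y ⊆ V) :
    IsClosed {p : X × X | p.2 ∈ closure (F p.1)} := by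
  simp only [closure_eq_Fhat hmem hpap]
  rw [← isOpen_compl_iff, isOpen_iff_mem_nhds]
  rintro ⟨x, y⟩ hxy
  have hdisj : Disjoint (Fhat F x) {y} := Set.disjoint_singleton_right.mpr hxy
  obtain ⟨U, W, hU, hW, hxU, hyW, hUW⟩ :=
    SeparatedNhds.of_isCompact_isCompact (husc₁ x).2 isCompact_singleton hdisj
  obtain ⟨V, hxV, hVU, hV⟩ := husc₂ x U hU hxU
  have hx : x ∈ Fhat F x := rfl
  filter_upwards [prod_mem_nhds (isOpen_interior.mem_nhds (hxV hx))
    (hW.mem_nhds (hyW rfl))] with p hp hpF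
  exact Set.disjoint_left.mp hUW (hVU (hV p.1 (interior_subset hp.1) hpF)) hp.2
end

section
/- Let F be a decomposition of a compact Hausdorff topological space X. If F is R-closed, then F is pointwise almost periodic and the class decomposition F̂ is upper semicontinuous. -/
open Set Topology

/-- In an `R`-closed decomposition, every point of an element closure generates that closure. -/
theorem closure_eq_of_mem_closure {X : Type*} [TopologicalSpace X] {F : X → Set X}
    (hmem : ∀ x, x ∈ F x) (hpart : ∀ x y, y ∈ F x → F y = F x)
    (hR : IsClosed {p : X × X | p.2 ∈ closure (F p.1)}) {x y : X}
    (hy : y ∈ closure (F x)) : closure (F y) = closure (F x) := by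
  have hsub : ∀ {a b : X}, b ∈ closure (F a) → closure (F a) ⊆ closure (F b) := by
    intro a b hb z hz
    have hcl : IsClosed {w | z ∈ closure (F w)} :=
      hR.preimage (Continuous.prodMk continuous_id continuous_const : Continuous fun w => (w, z))
    refine closure_minimal (fun w hw => ?_) hcl hb
    rw [mem_ofPred_eq, hpart a w hw]
    exact hz
  exact (hsub (hsub hy (subset_closure (hmem x)))).antisymm (hsub hy)

/-- In an `R`-closed decomposition, classes are the closures of the elements. -/
theorem Fhat_eq_closure {X : Type*} [TopologicalSpace X] {F : X → Set X}
    (hmem : ∀ x, x ∈ F x) (hpart : ∀ x y, y ∈ F x → F y = F x)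
    (hR : IsClosed {p : X × X | p.2 ∈ closure (F p.1)}) (x : X) :
    Fhat F x = closure (F x) := by
  ext y
  exact ⟨fun h => h ▸ subset_closure (hmem y), closure_eq_of_mem_closure hmem hpart hR⟩

/-- In a compact space, the points whose element closure lies in a given open set form an
open set. -/
theorem isOpen_setOf_closure_subset {X : Type*} [TopologicalSpace X] [CompactSpace X]
    {F : X → Set X} (hR : IsClosed {p : X × X | p.2 ∈ closure (F p.1)}) {U : Set X}
    (hU : IsOpen U) : IsOpen {w | closure (F w) ⊆ U} := by
  have h := isClosedMap_fst_of_compactSpace _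
    (hR.inter (hU.isClosed_compl.preimage (continuous_snd (X := X))))
  convert h.isOpen_compl using 1
  ext w
  simp [Set.subset_def]

/-- An `R`-closed decomposition `F` of a compact Hausdorff space is pointwise almost
periodic and its class decomposition `F̂` is upper semicontinuous. -/
theorem stmt1 {X : Type*} [TopologicalSpace X] [CompactSpace X] [T2Space X]
    (F : X → Set X)
    (hmem : ∀ x, x ∈ F x)
    (hpart : ∀ x y, y ∈ F x → F y = F x)
    (hR : IsClosed {p : X × X | p.2 ∈ closure (F p.1)}) :
    (∀ x y, closure (F x) = closure (F y) ∨ Disjoint (closure (F x)) (closure (F y))) ∧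
    (∀ x, IsClosed (Fhat F x) ∧ IsCompact (Fhat F x)) ∧
    (∀ x, ∀ U : Set X, IsOpen U → Fhat F x ⊆ U →
      ∃ V : Set X, Fhat F x ⊆ interior V ∧ V ⊆ U ∧ ∀ y ∈ V, Fhat F y ⊆ V) := by
  have hcls := Fhat_eq_closure hmem hpart hR
  refine ⟨fun x y => ?_, fun x => ?_, fun x U hU hxU => ?_⟩
  · refine or_iff_not_imp_right.2 fun h => ?_
    obtain ⟨z, hzx, hzy⟩ := not_disjoint_iff.1 h
    exact (closure_eq_of_mem_closure hmem hpart hR hzx).symm.trans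
      (closure_eq_of_mem_closure hmem hpart hR hzy)
  · rw [hcls]
    exact ⟨isClosed_closure, isClosed_closure.isCompact⟩
  · refine ⟨{w | closure (F w) ⊆ U}, ?_, fun w hw => hw (subset_closure (hmem w)), ?_⟩
    · rw [(isOpen_setOf_closure_subset hR hU).interior_eq]
      intro w hw
      rw [mem_ofPred_eq, show closure (F w) = closure (F x) from hw, ← hcls]
      exact hxU
    · intro y hy w hw
      rw [mem_ofPred_eq, show closure (F w) = closure (F y) from hw]
      exact hy
end

section
/- Let F be a pointwise almost periodic decomposition of a topological space X. Then every open F-saturated subset of X is F̂-saturated, i.e., if U is open and U = ⋃_{x ∈ U} F(x), then U = ⋃_{x ∈ U} F̂(x). -/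
open Set Topology

/-- For a pointwise almost periodic decomposition `F`, every open `F`-saturated set
is `F̂`-saturated. -/
theorem stmt2 {X : Type*} [TopologicalSpace X]
    (F : X → Set X)
    (hmem : ∀ x, x ∈ F x)
    (hpart : ∀ x y, y ∈ F x → F y = F x)
    (hpap : ∀ x y, closure (F x) = closure (F y) ∨ Disjoint (closure (F x)) (closure (F y)))
    (U : Set X) (hU : IsOpen U) (hsat : U = ⋃ x ∈ U, F x) :
    U = ⋃ x ∈ U, Fhat F x := by
  refine Subset.antisymm (fun x hx => mem_iUnion₂.2 ⟨x, hx, rfl⟩) ?_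
  refine iUnion₂_subset fun x hx y hy => ?_
  have hxy : x ∈ closure (F y) := by
    rw [show closure (F y) = closure (F x) from hy]
    exact subset_closure (hmem x)
  obtain ⟨z, hzU, hzy⟩ := mem_closure_iff.1 hxy U hU hx
  rw [hsat]
  exact mem_iUnion₂.2 ⟨z, hzU, hpart y z hzy ▸ hmem y⟩
end

section
/- Let F be a pointwise almost periodic decomposition of a normal topological space X. Suppose that for every element L of F and every open neighbourhood W of L there is an open F-saturated neighbourhood of L contained in W. Then the class space X/F̂ (the quotient of X by the equivalence relation x ∼ y ⟺ closure(F(x)) = closure(F(y)), with the quotient topology) is Hausdorff. -/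
open Set Topology

/-- The setoid on `X` identifying points whose decomposition elements have equal closures. -/
def classSetoid {X : Type*} [TopologicalSpace X] (F : X → Set X) : Setoid X where
  r x y := closure (F x) = closure (F y)
  iseqv := ⟨fun _ => rfl, fun h => h.symm, fun h₁ h₂ => h₁.trans h₂⟩

/-- An open set saturated for a decomposition is saturated for the decomposition into classes. -/
theorem mem_of_closure_eq_of_isOpen_of_saturated {X : Type*} [TopologicalSpace X]
    {F : X → Set X} (hmem : ∀ x, x ∈ F x) (hpart : ∀ x y, y ∈ F x → F y = F x)
    {V : Set X} (hV : IsOpen V) (hsat : ∀ y ∈ V, F y ⊆ V) {z w : X} (hz : z ∈ V)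
    (h : closure (F z) = closure (F w)) : w ∈ V := by
  have hzw : z ∈ closure (F w) := h ▸ subset_closure (hmem z)
  obtain ⟨u, huV, huw⟩ := mem_closure_iff.1 hzw V hV hz
  exact hsat u huV (hpart w u huw ▸ hmem w)

/-- The image of an open saturated set in the class space is open. -/
theorem isOpen_image_mk_of_saturated {X : Type*} [TopologicalSpace X]
    {F : X → Set X} (hmem : ∀ x, x ∈ F x) (hpart : ∀ x y, y ∈ F x → F y = F x)
    {V : Set X} (hV : IsOpen V) (hsat : ∀ y ∈ V, F y ⊆ V) :
    IsOpen (Quotient.mk (classSetoid F) '' V) := by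
  refine isQuotientMap_quotient_mk'.isOpen_preimage.1 ?_
  convert hV using 1
  ext w
  refine ⟨?_, fun hw => ⟨w, hw, rfl⟩⟩
  rintro ⟨z, hz, hzw⟩
  exact mem_of_closure_eq_of_isOpen_of_saturated hmem hpart hV hsat hz (Quotient.exact hzw)

/-- If a pointwise almost periodic decomposition of a normal space is such that each
element admits arbitrarily small open saturated neighbourhoods, then the class space
`X/F̂` is Hausdorff. -/
theorem stmt3 {X : Type*} [TopologicalSpace X] [NormalSpace X]
    (F : X → Set X)
    (hmem : ∀ x, x ∈ F x)
    (hpart : ∀ x y, y ∈ F x → F y = F x)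
    (hpap : ∀ x y, closure (F x) = closure (F y) ∨ Disjoint (closure (F x)) (closure (F y)))
    (hnbhd : ∀ x, ∀ W : Set X, IsOpen W → F x ⊆ W →
      ∃ V : Set X, IsOpen V ∧ F x ⊆ V ∧ V ⊆ W ∧ ∀ y ∈ V, F y ⊆ V) :
    T2Space (Quotient (classSetoid F)) := by
  refine ⟨?_⟩
  rintro ⟨x⟩ ⟨y⟩ hxy
  have hdisj : Disjoint (closure (F x)) (closure (F y)) :=
    (hpap x y).resolve_left fun h => hxy (Quotient.sound h)
  obtain ⟨U₁, U₂, hU₁, hU₂, hx, hy, hU⟩ :=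
    normal_separation isClosed_closure isClosed_closure hdisj
  obtain ⟨V₁, hV₁, hxV, hVU₁, hsat₁⟩ := hnbhd x U₁ hU₁ (subset_closure.trans hx)
  obtain ⟨V₂, hV₂, hyV, hVU₂, hsat₂⟩ := hnbhd y U₂ hU₂ (subset_closure.trans hy)
  refine ⟨_, _, isOpen_image_mk_of_saturated hmem hpart hV₁ hsat₁,
    isOpen_image_mk_of_saturated hmem hpart hV₂ hsat₂,
    ⟨x, hxV (hmem x), rfl⟩, ⟨y, hyV (hmem y), rfl⟩, Set.disjoint_left.2 ?_⟩
  rintro _ ⟨z, hz, rfl⟩ ⟨w, hw, hwz⟩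
  have hzV : z ∈ V₂ :=
    mem_of_closure_eq_of_isOpen_of_saturated hmem hpart hV₂ hsat₂ hw (Quotient.exact hwz)
  exact Set.disjoint_left.1 hU (hVU₁ hz) (hVU₂ hzV)
end

section
/- Let F be a pointwise almost periodic decomposition of a compact Hausdorff topological space X. Then F is R-closed if and only if the class space X/F̂ is Hausdorff. -/
open Set Topology

/-- A surjective closed map from a normal space with closed fibers has Hausdorff codomain. -/
theorem IsClosedMap.t2Space_of_surjective {X Y : Type*} [TopologicalSpace X] [TopologicalSpace Y]
    [NormalSpace X] {f : X → Y} (hf : IsClosedMap f) (hsurj : Function.Surjective f)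
    (hfib : ∀ y, IsClosed (f ⁻¹' {y})) : T2Space Y := by
  refine ⟨fun a b hab => ?_⟩
  obtain ⟨u, v, hu, hv, hau, hbv, huv⟩ := normal_separation (hfib a) (hfib b)
    (Disjoint.preimage f (disjoint_singleton.2 hab))
  refine ⟨kernImage f u, kernImage f v, isClosedMap_iff_kernImage.1 hf hu,
    isClosedMap_iff_kernImage.1 hf hv, fun x hx => hau hx, fun x hx => hbv hx, ?_⟩
  rw [disjoint_left]
  intro y hyu hyv
  obtain ⟨x, rfl⟩ := hsurj y
  exact disjoint_left.1 huv (hyu rfl) (hyv rfl)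

/-- The quotient map of a compact space by a closed equivalence relation is closed. -/
theorem Setoid.isClosedMap_mk_of_isClosed {X : Type*} [TopologicalSpace X] [CompactSpace X]
    (s : Setoid X) (hs : IsClosed {p : X × X | s p.1 p.2}) :
    IsClosedMap (Quotient.mk s) := by
  intro C hC
  rw [← isQuotientMap_quotient_mk'.isClosed_preimage]
  have hsat : Quotient.mk s ⁻¹' (Quotient.mk s '' C) =
      Prod.snd '' ({p : X × X | s p.1 p.2} ∩ Prod.fst ⁻¹' C) := by
    ext y
    constructor
    · rintro ⟨x, hx, hxy⟩
      exact ⟨(x, y), ⟨Quotient.exact hxy, hx⟩, rfl⟩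
    · rintro ⟨⟨x, y⟩, ⟨hxy, hx⟩, rfl⟩
      exact ⟨x, hx, Quotient.sound hxy⟩
  change IsClosed (Quotient.mk s ⁻¹' (Quotient.mk s '' C))
  rw [hsat]
  exact isClosedMap_snd_of_compactSpace _ (hs.inter (hC.preimage continuous_fst))

/-- An equivalence relation on a compact Hausdorff space is closed if and only if its quotient
is Hausdorff. -/
theorem Setoid.isClosed_iff_t2Space_quotient {X : Type*} [TopologicalSpace X] [CompactSpace X]
    [T2Space X] (s : Setoid X) :
    IsClosed {p : X × X | s p.1 p.2} ↔ T2Space (Quotient s) := by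
  constructor
  · intro hs
    refine (s.isClosedMap_mk_of_isClosed hs).t2Space_of_surjective Quotient.mk_surjective ?_
    intro y
    obtain ⟨x, rfl⟩ := Quotient.mk_surjective y
    rw [← image_singleton]
    exact (s.isClosedMap_mk_of_isClosed hs _ isClosed_singleton).preimage continuous_quotient_mk'
  · intro _
    have hcont : Continuous (Quotient.mk s) := continuous_quotient_mk'
    have heq : {p : X × X | s p.1 p.2} = {p | Quotient.mk s p.1 = Quotient.mk s p.2} := by
      ext p
      exact Quotient.eq.symm
    rw [heq]
    exact isClosed_eq (hcont.comp continuous_fst) (hcont.comp continuous_snd)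

/-- A pointwise almost periodic decomposition of a compact Hausdorff space is `R`-closed
if and only if the class space `X/F̂` is Hausdorff. -/
theorem stmt4 {X : Type*} [TopologicalSpace X] [CompactSpace X] [T2Space X]
    (F : X → Set X)
    (hmem : ∀ x, x ∈ F x)
    (hpart : ∀ x y, y ∈ F x → F y = F x)
    (hpap : ∀ x y, closure (F x) = closure (F y) ∨ Disjoint (closure (F x)) (closure (F y))) :
    IsClosed {p : X × X | p.2 ∈ closure (F p.1)} ↔ T2Space (Quotient (classSetoid F)) := by
  have heq : {p : X × X | p.2 ∈ closure (F p.1)} = {p | classSetoid F p.1 p.2} := by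
    ext ⟨x, y⟩
    change y ∈ closure (F x) ↔ closure (F x) = closure (F y)
    have hy : y ∈ closure (F y) := subset_closure (hmem y)
    exact ⟨fun hyx => (hpap x y).resolve_right fun hd => disjoint_left.1 hd hyx hy,
      fun h => h ▸ hy⟩
  rw [heq]
  exact (classSetoid F).isClosed_iff_t2Space_quotient
end

section
/- Let F be a pointwise almost periodic decomposition of a compact Hausdorff topological space X. Then F is R-closed if and only if for every closed subset A of X the F̂-saturation ⋃_{x ∈ A} F̂(x) is closed (equivalently, the quotient map X → X/F̂ is a closed map). -/
open Set Topology

theorem mem_closure_iff_mem_Fhat {X : Type*} [TopologicalSpace X] {F : X → Set X}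
    (hmem : ∀ x, x ∈ F x)
    (hpap : ∀ x y, closure (F x) = closure (F y) ∨ Disjoint (closure (F x)) (closure (F y)))
    {x y : X} : y ∈ closure (F x) ↔ y ∈ Fhat F x := by
  have hy : y ∈ closure (F y) := subset_closure (hmem y)
  refine ⟨fun h => ?_, fun h : closure (F y) = closure (F x) => h ▸ hy⟩
  exact (hpap y x).resolve_right fun hd => disjoint_left.mp hd hy h

/-- A pointwise almost periodic decomposition of a compact Hausdorff space is `R`-closed
if and only if the `F̂`-saturation of every closed set is closed. -/
theorem stmt5 {X : Type*} [TopologicalSpace X] [CompactSpace X] [T2Space X]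
    (F : X → Set X)
    (hmem : ∀ x, x ∈ F x)
    (hpart : ∀ x y, y ∈ F x → F y = F x)
    (hpap : ∀ x y, closure (F x) = closure (F y) ∨ Disjoint (closure (F x)) (closure (F y))) :
    IsClosed {p : X × X | p.2 ∈ closure (F p.1)} ↔
      ∀ A : Set X, IsClosed A → IsClosed (⋃ x ∈ A, Fhat F x) := by
  constructor
  · intro hR A hA
    have heq : (⋃ x ∈ A, Fhat F x) =
        Prod.snd '' ({p : X × X | p.2 ∈ closure (F p.1)} ∩ Prod.fst ⁻¹' A) := by
      ext y
      simp [← mem_closure_iff_mem_Fhat hmem hpap, and_comm]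
    rw [heq]
    exact isClosedMap_snd_of_compactSpace _ (hR.inter (hA.preimage continuous_fst))
  · intro hsat
    rw [← isOpen_compl_iff, isOpen_iff_mem_nhds]
    rintro ⟨x, y⟩ (hxy : y ∉ closure (F x))
    obtain ⟨U, V, hU, hV, hxU, hyV, hUV⟩ :=
      SeparatedNhds.of_isCompact_isCompact (isClosed_closure (s := F x)).isCompact
        (isCompact_singleton (x := y)) (disjoint_singleton_right.mpr hxy)
    have hopen := (hsat Uᶜ hU.isClosed_compl).isOpen_compl
    have hx : x ∈ (⋃ z ∈ Uᶜ, Fhat F z)ᶜ := by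
      simp only [mem_compl_iff, mem_iUnion, not_exists]
      intro z hz hxz
      have hxz' : closure (F x) = closure (F z) := hxz
      exact hz (hxU (hxz' ▸ subset_closure (hmem z)))
    filter_upwards [prod_mem_nhds (hopen.mem_nhds hx) (hV.mem_nhds (hyV rfl))]
    rintro ⟨a, b⟩ ⟨ha, hb⟩ (hab : b ∈ closure (F a))
    refine ha (mem_biUnion (fun hbU => disjoint_left.mp hUV hbU hb) ?_)
    exact ((mem_closure_iff_mem_Fhat hmem hpap).mp hab).symm
end

section
/- Let F be a decomposition of a compact topological space X, let G be a decomposition of a Hausdorff topological space Y, and let p : X → Y be a semi-conjugacy from F to G (a continuous surjection with p(F(x)) = G(p(x)) for every x ∈ X). If F is pointwise almost periodic, then so is G. -/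
open Set Topology

/-- A semi-conjugacy from a decomposition `F` of a compact space onto a decomposition
`G` of a Hausdorff space carries pointwise almost periodicity of `F` to `G`. -/
theorem stmt10 {X Y : Type*} [TopologicalSpace X] [CompactSpace X]
    [TopologicalSpace Y] [T2Space Y]
    (F : X → Set X) (hFmem : ∀ x, x ∈ F x) (hFpart : ∀ x y, y ∈ F x → F y = F x)
    (G : Y → Set Y) (hGmem : ∀ y, y ∈ G y) (hGpart : ∀ y z, z ∈ G y → G z = G y)
    (p : X → Y) (hp : Continuous p) (hps : Function.Surjective p)
    (hsemi : ∀ x, p '' F x = G (p x))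
    (hpap : ∀ x y, closure (F x) = closure (F y) ∨ Disjoint (closure (F x)) (closure (F y))) :
    ∀ a b : Y, closure (G a) = closure (G b) ∨ Disjoint (closure (G a)) (closure (G b)) := by
  have himage : ∀ x, p '' closure (F x) = closure (G (p x)) := fun x => by
    rw [image_closure_of_isCompact isClosed_closure.isCompact hp.continuousOn, hsemi]
  have hclosure : ∀ a c, c ∈ closure (G a) → closure (G c) = closure (G a) := by
    intro a c hc
    obtain ⟨x, rfl⟩ := hps a
    rw [← himage] at hc
    obtain ⟨z, hz, rfl⟩ := hc
    rw [← himage, ← himage]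
    rcases hpap z x with h | h
    · rw [h]
    · exact absurd hz (Set.disjoint_left.mp h (subset_closure (hFmem z)))
  intro a b
  by_cases h : Disjoint (closure (G a)) (closure (G b))
  · exact Or.inr h
  · obtain ⟨c, hca, hcb⟩ := Set.not_disjoint_iff.mp h
    exact Or.inl ((hclosure a c hca).symm.trans (hclosure b c hcb))
end

section
/- Let F be a decomposition of a compact Hausdorff topological space X and G a decomposition of a compact Hausdorff topological space Y, and suppose there exists a semi-conjugacy p : X → Y from F to G. If F is R-closed, then so is G. -/
open Set Topology

/-- A semi-conjugacy between decompositions of compact Hausdorff spaces carries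
`R`-closedness of the source decomposition to the target decomposition. -/
theorem stmt13 {X Y : Type*} [TopologicalSpace X] [CompactSpace X] [T2Space X]
    [TopologicalSpace Y] [CompactSpace Y] [T2Space Y]
    (F : X → Set X) (hFmem : ∀ x, x ∈ F x) (hFpart : ∀ x y, y ∈ F x → F y = F x)
    (G : Y → Set Y) (hGmem : ∀ y, y ∈ G y) (hGpart : ∀ y z, z ∈ G y → G z = G y)
    (p : X → Y) (hp : Continuous p) (hps : Function.Surjective p)
    (hsemi : ∀ x, p '' F x = G (p x))
    (hR : IsClosed {q : X × X | q.2 ∈ closure (F q.1)}) :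
    IsClosed {q : Y × Y | q.2 ∈ closure (G q.1)} := by
  have himage : {q : Y × Y | q.2 ∈ closure (G q.1)} =
      Prod.map p p '' {q : X × X | q.2 ∈ closure (F q.1)} := by
    have hclosure (x : X) : closure (G (p x)) = p '' closure (F x) := by
      rw [← hsemi x, hp.isClosedMap.closure_image_eq_of_continuous hp]
    ext ⟨y, z⟩
    constructor
    · intro hz
      obtain ⟨x, rfl⟩ := hps y
      change z ∈ closure (G (p x)) at hz
      rw [hclosure] at hz
      obtain ⟨w, hw, rfl⟩ := hz
      exact ⟨(x, w), hw, rfl⟩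
    · rintro ⟨⟨x, w⟩, hw, hxw⟩
      obtain ⟨rfl, rfl⟩ := Prod.mk.inj hxw
      change p w ∈ closure (G (p x))
      rw [hclosure]
      exact mem_image_of_mem p hw
  rw [himage]
  exact (hp.prodMap hp).isClosedMap _ hR
end

section
/- Let f be a homeomorphism of a locally connected compact metrizable space X, let g be a homeomorphism of a compact metrizable space Y, and let h : X → Y be a continuous surjection such that h maps each f-orbit onto a g-orbit (h(O_f(x)) = O_g(h(x)) for all x ∈ X) and every fiber h⁻¹(y) is finite. Suppose f is pointwise almost periodic. If for some x ∈ X the closure of the g-orbit of h(x) is a Cantor set, then the closure of the f-orbit of x is a Cantor set. -/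
open Set Topology

/-- The (full) orbit of `x` under a bijection `f`. -/
def orbitZ {X : Type*} (f : Equiv.Perm X) (x : X) : Set X :=
  {y | ∃ n : ℤ, (f ^ n) x = y}

/-- A Cantor set: a nonempty compact perfect totally disconnected subset. -/
def IsCantorSet {X : Type*} [TopologicalSpace X] (C : Set X) : Prop :=
  C.Nonempty ∧ IsCompact C ∧ Perfect C ∧ IsTotallyDisconnected C

theorem orbitZ_self_mem {X : Type*} (f : Equiv.Perm X) (x : X) : x ∈ orbitZ f x :=
  ⟨0, by simp⟩

theorem orbitZ_mem_symm {X : Type*} {f : Equiv.Perm X} {x y : X} (hy : y ∈ orbitZ f x) :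
    x ∈ orbitZ f y := by
  obtain ⟨n, rfl⟩ := hy
  exact ⟨-n, by simp⟩

theorem orbitZ_countable {X : Type*} (f : Equiv.Perm X) (x : X) : (orbitZ f x).Countable :=
  countable_range fun n : ℤ => (f ^ n) x

/-- If all orbit closures of points of a closed set `K` equal `K`, and `z` is an isolated point
of `K`, then `K` is contained in the orbit of `z`. -/
theorem subset_orbitZ_of_not_accPt {X : Type*} [TopologicalSpace X] {f : Equiv.Perm X}
    {K : Set X} (hK : ∀ y ∈ K, closure (orbitZ f y) = K) {z : X} (hz : z ∈ K)
    (hacc : ¬ AccPt z (Filter.principal K)) : K ⊆ orbitZ f z := by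
  intro y hy
  rw [accPt_iff_nhds] at hacc
  push Not at hacc
  obtain ⟨U, hU, hUK⟩ := hacc
  obtain ⟨w, hwU, hwy⟩ := mem_closure_iff_nhds.1 ((hK y hy).symm ▸ hz) U hU
  have hwK : w ∈ K := hK y hy ▸ subset_closure hwy
  exact orbitZ_mem_symm (hUK w ⟨hwU, hwK⟩ ▸ hwy)

/-- A nonempty perfect set in a compact metrizable space is uncountable. -/
theorem Perfect.not_countable_of_compactSpace {Y : Type*} [TopologicalSpace Y] [CompactSpace Y]
    [TopologicalSpace.MetrizableSpace Y] {C : Set Y} (hC : Perfect C) (hne : C.Nonempty) :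
    ¬ C.Countable := by
  let _ := TopologicalSpace.metrizableSpaceMetric Y
  obtain ⟨φ, hφC, -, hφ⟩ := hC.exists_nat_bool_injection hne
  intro hcount
  have : Countable (ℕ → Bool) :=
    have := (hcount.mono hφC).to_subtype
    (rangeFactorization_injective.2 hφ).countable
  have hcard := Cardinal.mk_le_aleph0_iff.2 this
  rw [← Cardinal.power_def, Cardinal.mk_bool, Cardinal.mk_nat] at hcard
  exact (Cardinal.cantor Cardinal.aleph0).not_ge hcard

/-- The preimage of a totally disconnected set under a continuous map with finite fibers into it
is totally disconnected. -/
theorem IsTotallyDisconnected.of_mapsTo_of_finite_fibers {X Y : Type*} [TopologicalSpace X]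
    [T1Space X] [TopologicalSpace Y] {h : X → Y} (hc : Continuous h)
    (hfin : ∀ y, (h ⁻¹' {y}).Finite) {K : Set X} {C : Set Y} (hKC : MapsTo h K C)
    (hC : IsTotallyDisconnected C) : IsTotallyDisconnected K := by
  intro t htK ht
  have hsub : (h '' t).Subsingleton :=
    hC _ (hKC.mono_left htK).image_subset (ht.image h hc.continuousOn)
  rcases t.eq_empty_or_nonempty with rfl | ⟨a, ha⟩
  · exact subsingleton_empty
  · have htfin : t.Finite := (hfin (h a)).subset fun b hb =>
      hsub (mem_image_of_mem h hb) (mem_image_of_mem h ha)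
    have := htfin.to_subtype
    exact ht.isDiscrete_iff_subsingleton.1 ⟨inferInstance⟩

/-- Let `h` be a finite-to-one continuous surjective semi-conjugacy from a pointwise
almost periodic homeomorphism `f` of a locally connected compact metrizable space onto
a homeomorphism `g` of a compact metrizable space. If the orbit closure of `h x` under
`g` is a Cantor set, then so is the orbit closure of `x` under `f`. -/
theorem stmt15 {X Y : Type*} [TopologicalSpace X] [CompactSpace X]
    [TopologicalSpace.MetrizableSpace X] [LocallyConnectedSpace X]
    [TopologicalSpace Y] [CompactSpace Y] [TopologicalSpace.MetrizableSpace Y]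
    (f : X ≃ₜ X) (g : Y ≃ₜ Y)
    (h : X → Y) (hc : Continuous h) (hs : Function.Surjective h)
    (horb : ∀ x, h '' orbitZ f.toEquiv x = orbitZ g.toEquiv (h x))
    (hfin : ∀ y : Y, (h ⁻¹' {y}).Finite)
    (hpap : ∀ x y : X, closure (orbitZ f.toEquiv x) = closure (orbitZ f.toEquiv y) ∨
      Disjoint (closure (orbitZ f.toEquiv x)) (closure (orbitZ f.toEquiv y)))
    (x : X) (hC : IsCantorSet (closure (orbitZ g.toEquiv (h x)))) :
    IsCantorSet (closure (orbitZ f.toEquiv x)) := by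
  set K := closure (orbitZ f.toEquiv x) with hKdef
  have hxK : x ∈ K := subset_closure (orbitZ_self_mem _ x)
  have hKmin : ∀ y ∈ K, closure (orbitZ f.toEquiv y) = K := fun y hy =>
    (hpap y x).resolve_right
      (not_disjoint_iff.2 ⟨y, subset_closure (orbitZ_self_mem _ y), hy⟩)
  have himage : h '' K = closure (orbitZ g.toEquiv (h x)) := by
    rw [hKdef, ← horb x]
    exact image_closure_of_isCompact isClosed_closure.isCompact hc.continuousOn
  obtain ⟨hne, -, hperf, htd⟩ := hC
  refine ⟨⟨x, hxK⟩, isClosed_closure.isCompact, ⟨isClosed_closure, fun z hz => ?_⟩,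
    htd.of_mapsTo_of_finite_fibers hc hfin (mapsTo_iff_image_subset.2 himage.subset)⟩
  by_contra hacc
  have hKcount : K.Countable :=
    (orbitZ_countable _ z).mono (subset_orbitZ_of_not_accPt hKmin hz hacc)
  exact hperf.not_countable_of_compactSpace hne (himage ▸ hKcount.image h)
end

section
/- Let f be a pointwise almost periodic homeomorphism of a locally connected compact metrizable space X and let x ∈ X. If the closure of the f-orbit of x is a Cantor set, then for every positive integer N the closure of the f^N-orbit of x (the closure of {f^{kN}(x) | k ∈ ℤ}) is a Cantor set. -/
open Set Topology

/-- An injective continuous map sends accumulation points of `A` to accumulation points of any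
set containing its image. -/
lemma mem_closure_diff_singleton_of_mapsTo {X Y : Type*} [TopologicalSpace X]
    [TopologicalSpace Y] {g : X → Y} (hg : Continuous g) (hinj : Function.Injective g)
    {A : Set X} {B : Set Y} (hAB : MapsTo g A B) {a : X} (ha : a ∈ closure (A \ {a})) :
    g a ∈ closure (B \ {g a}) :=
  map_mem_closure hg ha fun _ hz => ⟨hAB hz.1, fun h => hz.2 (hinj h)⟩

lemma perm_zpow_apply_add {X : Type*} (e : Equiv.Perm X) (m n : ℤ) (x : X) :
    (e ^ (m + n)) x = (e ^ m) ((e ^ n) x) := by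
  rw [zpow_add, Equiv.Perm.mul_apply]

lemma Homeomorph.continuous_toEquiv_zpow {X : Type*} [TopologicalSpace X] (f : X ≃ₜ X) (n : ℤ) :
    Continuous (f.toEquiv ^ n : Equiv.Perm X) := by
  have h₁ : Continuous (f.toEquiv : Equiv.Perm X) := f.continuous
  have h₂ : Continuous ((f.toEquiv : Equiv.Perm X)⁻¹ : Equiv.Perm X) := f.symm.continuous
  obtain ⟨k, rfl | rfl⟩ := n.eq_nat_or_neg
  · rw [zpow_natCast, Equiv.Perm.coe_pow]
    exact h₁.iterate k
  · rw [zpow_neg, zpow_natCast, ← inv_pow, Equiv.Perm.coe_pow]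
    exact h₂.iterate k

lemma zpow_mul_mem_orbitZ_pow {X : Type*} (e : Equiv.Perm X) (N : ℕ) (k : ℤ) (x : X) :
    (e ^ ((N : ℤ) * k)) x ∈ orbitZ (e ^ N) x :=
  ⟨k, by rw [zpow_mul, zpow_natCast]⟩

section OrbitClosure

variable {X : Type*} [TopologicalSpace X] {e : Equiv.Perm X}

/-- If `e ^ n` moves `x` into the orbit closure of `x` under `e ^ N`, then it preserves this
orbit closure. -/
lemma mapsTo_closure_orbitZ_pow (he : ∀ n : ℤ, Continuous (e ^ n : Equiv.Perm X)) {x : X} {N : ℕ}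
    {n : ℤ} (h : (e ^ n) x ∈ closure (orbitZ (e ^ N) x)) :
    MapsTo (e ^ n : Equiv.Perm X) (closure (orbitZ (e ^ N) x)) (closure (orbitZ (e ^ N) x)) := by
  have invariant (k : ℤ) : MapsTo (e ^ ((N : ℤ) * k) : Equiv.Perm X)
      (closure (orbitZ (e ^ N) x)) (closure (orbitZ (e ^ N) x)) := by
    refine MapsTo.closure ?_ (he _)
    rintro _ ⟨l, rfl⟩
    rw [← zpow_natCast, ← zpow_mul, ← perm_zpow_apply_add, ← mul_add, zpow_mul, zpow_natCast]
    exact ⟨_, rfl⟩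
  refine closure_minimal (t := (e ^ n : Equiv.Perm X) ⁻¹' closure (orbitZ (e ^ N) x)) ?_
    (isClosed_closure.preimage (he n))
  rintro _ ⟨k, rfl⟩
  rw [mem_preimage, ← zpow_natCast, ← zpow_mul, ← perm_zpow_apply_add, add_comm,
    perm_zpow_apply_add]
  simpa using invariant k h

/-- The powers `e ^ j`, `j < N`, of the orbit closure under `e ^ N` cover the orbit closure
under `e`. -/
lemma closure_orbitZ_subset_biUnion (he : ∀ n : ℤ, Continuous (e ^ n : Equiv.Perm X)) (x : X)
    {N : ℕ} (hN : 0 < N) :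
    closure (orbitZ e x) ⊆
      ⋃ j ∈ Finset.range N,
        (e ^ (-(j : ℤ)) : Equiv.Perm X) ⁻¹' closure (orbitZ (e ^ N) x) := by
  refine closure_minimal ?_ (isClosed_biUnion_finset fun j _ => isClosed_closure.preimage (he _))
  rintro _ ⟨n, rfl⟩
  have hN' : (0 : ℤ) < N := by exact_mod_cast hN
  have hmod := Int.emod_nonneg n hN'.ne'
  refine mem_iUnion₂.2 ⟨(n % N).toNat, ?_, ?_⟩
  · have := Int.emod_lt_of_pos n hN'
    rw [Finset.mem_range]
    omega
  · rw [mem_preimage, Int.toNat_of_nonneg hmod, ← perm_zpow_apply_add]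
    have : -(n % N) + n = N * (n / N) := by linarith [Int.emod_add_mul_ediv n N]
    rw [this]
    exact subset_closure (zpow_mul_mem_orbitZ_pow e N _ x)

/-- If `x` is an accumulation point of its orbit closure under `e`, then it is one of its orbit
closure under `e ^ N`. -/
lemma mem_closure_orbitZ_pow_diff (he : ∀ n : ℤ, Continuous (e ^ n : Equiv.Perm X)) {x : X}
    {N : ℕ} (hN : 0 < N) (hx : x ∈ closure (closure (orbitZ e x) \ {x})) :
    x ∈ closure (closure (orbitZ (e ^ N) x) \ {x}) := by
  set D := closure (orbitZ (e ^ N) x)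
  have hcover : closure (orbitZ e x) \ {x} ⊆
      ⋃ j ∈ Finset.range N, ((e ^ (-(j : ℤ)) : Equiv.Perm X) ⁻¹' D) \ {x} := fun z hz => by
    obtain ⟨j, hj, hzj⟩ := mem_iUnion₂.1 (closure_orbitZ_subset_biUnion he x hN hz.1)
    exact mem_iUnion₂.2 ⟨j, hj, hzj, hz.2⟩
  have hx' := closure_mono hcover hx
  rw [Finset.closure_biUnion] at hx'
  obtain ⟨j, -, hj⟩ := mem_iUnion₂.1 hx'
  have hjD : (e ^ (-(j : ℤ))) x ∈ D :=
    closure_minimal sdiff_subset (isClosed_closure.preimage (he _)) hj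
  have hneg : MapsTo (e ^ (-(j : ℤ)) : Equiv.Perm X) D D := mapsTo_closure_orbitZ_pow he hjD
  refine closure_mono (sdiff_subset_sdiff_left fun z hz => ?_) hj
  have hmul : MapsTo (e ^ ((N : ℤ) * j) : Equiv.Perm X) D D :=
    mapsTo_closure_orbitZ_pow he (subset_closure (zpow_mul_mem_orbitZ_pow e N j x))
  have hz' := hmul (hneg.iterate (N - 1) hz)
  rw [← Equiv.Perm.coe_pow, ← zpow_natCast (e ^ (-(j : ℤ))), ← zpow_mul,
    ← perm_zpow_apply_add, ← perm_zpow_apply_add] at hz'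
  have hexp : (N : ℤ) * j + -(j : ℤ) * ((N - 1 : ℕ) : ℤ) + -(j : ℤ) = 0 := by
    rw [Nat.cast_sub hN]
    push_cast
    ring
  rwa [hexp, zpow_zero, Equiv.Perm.one_apply] at hz'

end OrbitClosure

/-- If `f` is a pointwise almost periodic homeomorphism of a locally connected compact
metrizable space and the orbit closure of `x` under `f` is a Cantor set, then the orbit
closure of `x` under `f^N` is a Cantor set for every positive integer `N`. -/
theorem stmt16 {X : Type*} [TopologicalSpace X] [CompactSpace X]
    [TopologicalSpace.MetrizableSpace X] [LocallyConnectedSpace X]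
    (f : X ≃ₜ X)
    (hpap : ∀ x y : X, closure (orbitZ f.toEquiv x) = closure (orbitZ f.toEquiv y) ∨
      Disjoint (closure (orbitZ f.toEquiv x)) (closure (orbitZ f.toEquiv y)))
    (x : X) (hC : IsCantorSet (closure (orbitZ f.toEquiv x))) :
    ∀ N : ℕ, 0 < N → IsCantorSet (closure (orbitZ (f.toEquiv ^ N) x)) := by
  intro N hN
  set e : Equiv.Perm X := f.toEquiv
  have he : ∀ n : ℤ, Continuous (e ^ n : Equiv.Perm X) := f.continuous_toEquiv_zpow
  obtain ⟨-, -, hperf, htd⟩ := hC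
  have hsub : closure (orbitZ (e ^ N) x) ⊆ closure (orbitZ e x) := by
    refine closure_mono ?_
    rintro _ ⟨k, rfl⟩
    exact ⟨N * k, by rw [zpow_mul, zpow_natCast]⟩
  have hxe : x ∈ orbitZ e x := ⟨0, by simp⟩
  have hx : x ∈ closure (closure (orbitZ (e ^ N) x) \ {x}) :=
    mem_closure_orbitZ_pow_diff he hN <|
      mem_closure_iff_clusterPt.2 <| accPt_principal_iff_clusterPt.1 (hperf.acc x (subset_closure hxe))
  refine ⟨⟨x, subset_closure ⟨0, by simp⟩⟩, isClosed_closure.isCompact, ⟨isClosed_closure, ?_⟩,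
    fun t ht hpre => htd t (ht.trans hsub) hpre⟩
  have hder : closure (orbitZ (e ^ N) x) ⊆ derivedSet (closure (orbitZ (e ^ N) x)) := by
    refine closure_minimal ?_ (isClosed_derivedSet _)
    rintro _ ⟨k, rfl⟩
    have hk : (e ^ ((N : ℤ) * k)) x = ((e ^ N) ^ k) x := by rw [zpow_mul, zpow_natCast]
    rw [mem_derivedSet, accPt_principal_iff_clusterPt, ← mem_closure_iff_clusterPt, ← hk]
    exact mem_closure_diff_singleton_of_mapsTo (he _) (Equiv.injective _)
      (mapsTo_closure_orbitZ_pow he (subset_closure (zpow_mul_mem_orbitZ_pow e N k x))) hx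
  exact fun y hy => hder hy
end

section
/- On the torus T² = (ℝ/ℤ) × (ℝ/ℤ), consider the linear flows v and v' defined by v_t(x,y) = (x + t, y + √2·t) and v'_t(x,y) = (x + t, y + π·t) (mod 1 in each coordinate). Then every orbit of v and every orbit of v' is dense in T² (so the orbit class spaces of both flows are singletons), yet v and v' are not topologically equivalent: there is no homeomorphism h : T² → T² mapping each orbit of v onto an orbit of v'. -/
open Set Topology

/-- The orbit of a point `p` of the torus under the linear flow
`v_t(x, y) = (x + t, y + a·t)` with slope `a`. -/
noncomputable def linearOrbit (a : ℝ) (p : AddCircle (1 : ℝ) × AddCircle (1 : ℝ)) :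
    Set (AddCircle (1 : ℝ) × AddCircle (1 : ℝ)) :=
  {q | ∃ t : ℝ, q = (p.1 + (t : AddCircle (1 : ℝ)), p.2 + ((a * t : ℝ) : AddCircle (1 : ℝ)))}

/-- Integer combinations, with weight at most `C`, of the functions
`x ↦ (2x)ʲ / j! * exp (iωx)` with `ω ∈ {-1, 0, 1}` and `j ≤ d ω`. -/
inductive IntExpPoly (d : ℤ → ℕ) : ℝ → (ℝ → ℂ) → Prop
  | basis (k j : ℕ) (ω : ℤ) (hω : |ω| ≤ 1) (hj : j ≤ d ω) :
      IntExpPoly d (4 ^ j) (fun x => Complex.I ^ k *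
        ((2 * x) ^ j / (j.factorial : ℂ) * Complex.exp (ω * x * Complex.I)))
  | add {C D : ℝ} {f g : ℝ → ℂ} : IntExpPoly d C f → IntExpPoly d D g →
      IntExpPoly d (C + D) (fun x => f x + g x)
  | mono {C D : ℝ} {f : ℝ → ℂ} : IntExpPoly d C f → C ≤ D → IntExpPoly d D f

namespace IntExpPoly

variable {d d' : ℤ → ℕ} {C D : ℝ} {f g : ℝ → ℂ}

theorem I_pow_mul (h : IntExpPoly d C f) (m : ℕ) :
    IntExpPoly d C (fun x => Complex.I ^ m * f x) := by
  induction h with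
  | basis k j ω hω hj =>
    convert basis (m + k) j ω hω hj using 2
    rw [pow_add, mul_assoc]
  | add _ _ h₁ h₂ =>
    convert h₁.add h₂ using 2
    rw [mul_add]
  | mono _ hle h => exact h.mono hle

theorem sub (hf : IntExpPoly d C f) (hg : IntExpPoly d D g) :
    IntExpPoly d (C + D) (fun x => f x - g x) := by
  convert hf.add (hg.I_pow_mul 2) using 2
  rw [Complex.I_sq]; ring

/-- Multiplication by `2 / (i (ω' - ω))` for distinct `ω, ω' ∈ {-1, 0, 1}`. -/
theorem two_div_mul (hf : IntExpPoly d C f) (hC : 0 ≤ C) {ω ω' : ℤ} (hω : |ω| ≤ 1)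
    (hω' : |ω'| ≤ 1) (hne : ω' ≠ ω) :
    IntExpPoly d (2 * C) (fun x => 2 / ((ω' - ω : ℂ) * Complex.I) * f x) := by
  have hinv : ∀ z : ℂ, 2 / (z * Complex.I) = -(2 / z) * Complex.I := by
    intro z
    rw [← div_div, Complex.div_I]; ring
  have h1 := hf.I_pow_mul 1
  have h3 := hf.I_pow_mul 3
  have e3 : Complex.I ^ 3 = -Complex.I := by rw [pow_succ, Complex.I_sq]; ring
  simp only [e3, pow_one] at h1 h3
  have hcases : ω' - ω = 1 ∨ ω' - ω = 2 ∨ ω' - ω = -1 ∨ ω' - ω = -2 := by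
    rw [abs_le] at hω hω'; omega
  have hcast : (ω' - ω : ℂ) = ((ω' - ω : ℤ) : ℂ) := by push_cast; rfl
  rw [hcast, hinv]
  rcases hcases with h | h | h | h <;> rw [h]
  · convert (h3.add h3) using 1
    · ring
    · ext x; push_cast; ring
  · convert (h3.mono (by linarith : C ≤ 2 * C)) using 2
    push_cast; ring
  · convert (h1.add h1) using 1
    · ring
    · ext x; push_cast; ring
  · convert (h1.mono (by linarith : C ≤ 2 * C)) using 2
    push_cast; ring

theorem hasDerivAt_basis (j : ℕ) (ω : ℂ) (x : ℝ) :
    HasDerivAt (fun x : ℝ => (2 * x : ℂ) ^ (j + 1) / ((j + 1).factorial : ℂ) *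
        Complex.exp (ω * x * Complex.I))
      (2 * ((2 * x : ℂ) ^ j / (j.factorial : ℂ) * Complex.exp (ω * x * Complex.I)) +
        ω * Complex.I * ((2 * x : ℂ) ^ (j + 1) / ((j + 1).factorial : ℂ) *
          Complex.exp (ω * x * Complex.I))) x := by
  have h0 : HasDerivAt (fun x : ℝ => (x : ℂ)) 1 x := Complex.ofRealCLM.hasDerivAt
  have h1 := (((h0.const_mul 2).pow (j + 1)).div_const ((j + 1).factorial : ℂ)).mul
    ((h0.const_mul ω).mul_const Complex.I).cexp
  refine h1.congr_deriv ?_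
  have hj : (j.factorial : ℂ) ≠ 0 := by exact_mod_cast j.factorial_ne_zero
  have hj' : (j + 1 : ℂ) ≠ 0 := by exact_mod_cast j.succ_ne_zero
  simp only [Nat.factorial_succ, Nat.cast_mul, Nat.cast_add, Nat.cast_one,
    Nat.add_sub_cancel, Pi.pow_apply]
  field_simp

theorem hasDerivAt_exp (ω : ℂ) (x : ℝ) :
    HasDerivAt (fun x : ℝ => Complex.exp (ω * x * Complex.I))
      (ω * Complex.I * Complex.exp (ω * x * Complex.I)) x := by
  have h0 : HasDerivAt (fun x : ℝ => (x : ℂ)) 1 x := Complex.ofRealCLM.hasDerivAt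
  refine ((h0.const_mul ω).mul_const Complex.I).cexp.congr_deriv ?_
  ring

theorem exists_solution_basis (j : ℕ) {ω ω' : ℤ} (hω : |ω| ≤ 1) (hω' : |ω'| ≤ 1)
    (hne : ω' ≠ ω) (hj : j ≤ d ω') :
    ∃ F : ℝ → ℂ, IntExpPoly d (8 * 4 ^ j) F ∧ F 0 = 0 ∧ ∀ x : ℝ, HasDerivAt F
      (ω * Complex.I * F x +
        2 * ((2 * x) ^ j / (j.factorial : ℂ) * Complex.exp (ω' * x * Complex.I))) x := by
  have hμ : ((ω' - ω : ℂ) * Complex.I) ≠ 0 :=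
    mul_ne_zero (sub_ne_zero.2 (by exact_mod_cast hne)) Complex.I_ne_zero
  have hc : 2 / ((ω' - ω : ℂ) * Complex.I) * ((ω' - ω : ℂ) * Complex.I) = 2 :=
    div_mul_cancel₀ _ hμ
  induction j with
  | zero =>
    have hb := ((basis 0 0 ω' hω' hj).sub (basis 0 0 ω hω (Nat.zero_le _))).two_div_mul
      (by norm_num) hω hω' hne
    refine ⟨_, hb.mono (by norm_num), by simp, fun x => ?_⟩
    simp only [pow_zero, Nat.factorial_zero, Nat.cast_one, div_one, one_mul]
    refine (((hasDerivAt_exp ω' x).sub (hasDerivAt_exp ω x)).const_mul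
      (2 / ((ω' - ω : ℂ) * Complex.I))).congr_deriv ?_
    linear_combination Complex.exp (ω' * x * Complex.I) * hc
  | succ j ih =>
    obtain ⟨F, hF, hF0, hF'⟩ := ih (by omega)
    have hb := ((basis 0 (j + 1) ω' hω' hj).sub hF).two_div_mul (by positivity) hω hω' hne
    refine ⟨_, hb.mono (by rw [pow_succ]; linarith [pow_pos (by norm_num : (0 : ℝ) < 4) j]),
      by simp [hF0], fun x => ?_⟩
    simp only [pow_zero, one_mul]
    refine (((hasDerivAt_basis j ω' x).sub (hF' x)).const_mul
      (2 / ((ω' - ω : ℂ) * Complex.I))).congr_deriv ?_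
    linear_combination ((2 * x : ℂ) ^ (j + 1) / ((j + 1).factorial : ℂ) *
      Complex.exp (ω' * x * Complex.I)) * hc

/-- Solving `F' - iωF = 2f`, `F 0 = 0` within integer exponential polynomials. -/
theorem exists_solution (h : IntExpPoly d C f) {ω : ℤ} (hω : |ω| ≤ 1)
    (hd : ∀ ω, d ω ≤ d' ω) (hdω : d ω + 1 ≤ d' ω) :
    ∃ F : ℝ → ℂ, IntExpPoly d' (8 * C) F ∧ F 0 = 0 ∧
      ∀ x : ℝ, HasDerivAt F (ω * Complex.I * F x + 2 * f x) x := by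
  induction h with
  | basis k j ω' hω' hj =>
    by_cases hne : ω' = ω
    · subst hne
      refine ⟨_, (basis k (j + 1) ω' hω' (by omega)).mono ?_, by simp, fun x => ?_⟩
      · rw [pow_succ]; linarith [pow_pos (by norm_num : (0 : ℝ) < 4) j]
      · refine ((hasDerivAt_basis j ω' x).const_mul (Complex.I ^ k)).congr_deriv ?_
        ring
    · obtain ⟨F, hF, hF0, hF'⟩ := exists_solution_basis j hω hω' hne (hj.trans (hd ω'))
      refine ⟨_, hF.I_pow_mul k, by simp [hF0], fun x => ?_⟩
      refine ((hF' x).const_mul (Complex.I ^ k)).congr_deriv ?_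
      ring
  | add _ _ h₁ h₂ =>
    obtain ⟨F, hF, hF0, hF'⟩ := h₁
    obtain ⟨G, hG, hG0, hG'⟩ := h₂
    refine ⟨_, (hF.add hG).mono (by linarith), by simp [hF0, hG0], fun x => ?_⟩
    refine ((hF' x).add (hG' x)).congr_deriv ?_
    ring
  | mono _ hle h =>
    obtain ⟨F, hF, hF'⟩ := h
    exact ⟨F, hF.mono (by linarith), hF'⟩

end IntExpPoly

theorem pos_of_hasDerivAt_pos {f f' : ℝ → ℝ} {b : ℝ} (hf : ∀ x, HasDerivAt f (f' x) x)
    (h0 : f 0 = 0) (hpos : ∀ x ∈ Ioo 0 b, 0 < f' x) (hb : 0 < b) : 0 < f b := by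
  have hmono : StrictMonoOn f (Icc 0 b) :=
    strictMonoOn_of_deriv_pos (convex_Icc _ _)
      (fun x _ => (hf x).continuousAt.continuousWithinAt) fun x hx => by
        rw [interior_Icc] at hx
        rw [(hf x).deriv]
        exact hpos x hx
  simpa [h0] using hmono (left_mem_Icc.2 hb.le) (right_mem_Icc.2 hb.le) hb

theorem le_of_hasDerivAt_le {f f' g g' : ℝ → ℝ} {b : ℝ} (hf : ∀ x, HasDerivAt f (f' x) x)
    (hg : ∀ x, HasDerivAt g (g' x) x) (hf0 : f 0 = 0) (hg0 : g 0 = 0)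
    (hle : ∀ x ∈ Ioo 0 b, f' x ≤ g' x) (hb : 0 < b) : f b ≤ g b := by
  have hd : ∀ x, HasDerivAt (fun x => g x - f x) (g' x - f' x) x := fun x => (hg x).sub (hf x)
  have hmono : MonotoneOn (fun x => g x - f x) (Icc 0 b) :=
    monotoneOn_of_deriv_nonneg (convex_Icc _ _)
      (fun x _ => (hd x).continuousAt.continuousWithinAt)
      (fun x _ => (hd x).differentiableAt.differentiableWithinAt) fun x hx => by
        rw [interior_Icc] at hx
        rw [(hd x).deriv]
        exact sub_nonneg.2 (hle x hx)
  simpa [hf0, hg0] using hmono (left_mem_Icc.2 hb.le) (right_mem_Icc.2 hb.le) hb.le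

theorem hasDerivAt_pow_div_factorial (A : ℝ) (m : ℕ) (x : ℝ) :
    HasDerivAt (fun x : ℝ => A * (x ^ (m + 1) / (m + 1).factorial))
      (A * (x ^ m / m.factorial)) x := by
  refine (((hasDerivAt_pow (m + 1) x).div_const _).const_mul A).congr_deriv ?_
  have : (m.factorial : ℝ) ≠ 0 := by positivity
  rw [Nat.factorial_succ]
  push_cast [Nat.add_sub_cancel]
  field_simp

/-- Positivity on `(0, π]` of the solution of `h'' + h = r` with zero initial data. -/
theorem pos_of_oscillator {h k r : ℝ → ℝ} (hh : ∀ x, HasDerivAt h (k x) x)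
    (hk : ∀ x, HasDerivAt k (-h x + r x) x) (h0 : h 0 = 0) (k0 : k 0 = 0)
    (hr : ∀ x ∈ Ioc 0 Real.pi, 0 < r x) : ∀ t ∈ Ioc 0 Real.pi, 0 < h t := by
  intro t ht
  have key := pos_of_hasDerivAt_pos (b := t)
    (f := fun s => k s * Real.sin (t - s) + h s * Real.cos (t - s))
    (f' := fun s => r s * Real.sin (t - s)) (fun s => ?_) (by simp [h0, k0])
    (fun s hs => mul_pos (hr s ⟨hs.1, hs.2.le.trans ht.2⟩)
      (Real.sin_pos_of_pos_of_lt_pi (by linarith [hs.2]) (by linarith [hs.1, ht.2]))) ht.1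
  · simpa using key
  · have hs : HasDerivAt (fun s => t - s) (-1) s := by
      simpa using (hasDerivAt_id s).const_sub t
    refine (((hk s).mul hs.sin).add ((hh s).mul hs.cos)).congr_deriv ?_
    ring

theorem le_of_oscillator {h k r : ℝ → ℝ} (hh : ∀ x, HasDerivAt h (k x) x)
    (hk : ∀ x, HasDerivAt k (-h x + r x) x) (h0 : h 0 = 0) (k0 : k 0 = 0)
    (hpos : ∀ t ∈ Ioc 0 Real.pi, 0 < h t) {A : ℝ} {m : ℕ}
    (hr : ∀ x ∈ Ioc 0 Real.pi, r x ≤ A * (x ^ m / m.factorial)) :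
    ∀ t ∈ Ioc 0 Real.pi, h t ≤ A * (t ^ (m + 2) / (m + 2).factorial) := by
  intro t ht
  have h1 : ∀ s ∈ Ioc 0 Real.pi, k s ≤ A * (s ^ (m + 1) / (m + 1).factorial) := by
    intro s hs
    refine le_of_hasDerivAt_le hk (hasDerivAt_pow_div_factorial A m) k0 (by simp)
      (fun x hx => ?_) hs.1
    have hx' : x ∈ Ioc 0 Real.pi := ⟨hx.1, hx.2.le.trans hs.2⟩
    linarith [hr x hx', hpos x hx']
  exact le_of_hasDerivAt_le hh (hasDerivAt_pow_div_factorial A (m + 1)) h0 (by simp)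
    (fun x hx => h1 x ⟨hx.1, hx.2.le.trans ht.2⟩) ht.1

theorem hasDerivAt_re {f : ℝ → ℂ} {f' : ℂ} {x : ℝ} (h : HasDerivAt f f' x) :
    HasDerivAt (fun x => (f x).re) f'.re x :=
  (Complex.reCLM.hasFDerivAt.comp_hasDerivAt x h)

/-- Approximating forms: their real parts are, up to powers of `8`, the convolution powers of
`1 - cos`. -/
theorem exists_intExpPoly_pos_le (n : ℕ) :
    ∃ f : ℝ → ℂ, IntExpPoly (fun _ => n) (2 * 512 ^ n) f ∧ ∀ x ∈ Ioc 0 Real.pi,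
      0 < (f x).re ∧ (f x).re ≤ 8 ^ n * (x ^ (3 * n + 2) / (3 * n + 2).factorial) := by
  induction n with
  | zero =>
    have hb := (IntExpPoly.basis (d := fun _ => 0) 0 0 0 (by simp) le_rfl).sub
      (IntExpPoly.basis 0 0 1 (by simp) le_rfl)
    refine ⟨_, hb.mono (by norm_num), fun x hx => ?_⟩
    have hre : ((Complex.I ^ 0 * ((2 * x) ^ 0 / (Nat.factorial 0 : ℂ) *
        Complex.exp ((0 : ℤ) * x * Complex.I)) - Complex.I ^ 0 * ((2 * x) ^ 0 /
        (Nat.factorial 0 : ℂ) * Complex.exp ((1 : ℤ) * x * Complex.I))).re = 1 - Real.cos x) := by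
      simp [Complex.exp_ofReal_mul_I_re]
    rw [hre]
    have hc := Real.one_sub_sq_div_two_le_cos (x := x)
    have : Real.cos x < 1 := by
      rw [← Real.cos_zero]
      exact Real.cos_lt_cos_of_nonneg_of_le_pi le_rfl hx.2 hx.1
    constructor
    · linarith
    · norm_num [Nat.factorial]; linarith
  | succ n ih =>
    obtain ⟨f, hf, hb⟩ := ih
    obtain ⟨F₁, hF₁, hF₁0, hF₁'⟩ := hf.exists_solution (ω := -1)
      (d' := fun ω => if ω = -1 then n + 1 else n) (by simp)
      (fun ω => by split_ifs <;> omega) (by simp)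
    obtain ⟨F₂, hF₂, hF₂0, hF₂'⟩ := hF₁.exists_solution (ω := 1)
      (d' := fun ω => if ω = 0 then n else n + 1) (by simp)
      (fun ω => by split_ifs <;> omega) (by simp)
    obtain ⟨F₃, hF₃, hF₃0, hF₃'⟩ := hF₂.exists_solution (ω := 0)
      (d' := fun _ => n + 1) (by simp)
      (fun ω => by split_ifs <;> omega) (by simp)
    have hh : ∀ x, HasDerivAt (fun x => (F₂ x).re)
        (((1 : ℤ) : ℂ) * Complex.I * F₂ x + 2 * F₁ x).re x := fun x => hasDerivAt_re (hF₂' x)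
    have hk : ∀ x : ℝ, HasDerivAt (fun x => (((1 : ℤ) : ℂ) * Complex.I * F₂ x + 2 * F₁ x).re)
        (-(F₂ x).re + 4 * (f x).re) x := fun x => by
      refine (hasDerivAt_re (((hF₂' x).const_mul (((1 : ℤ) : ℂ) * Complex.I)).add
        ((hF₁' x).const_mul 2))).congr_deriv ?_
      simp
      ring
    have h0 : (F₂ 0).re = 0 := by simp [hF₂0]
    have k0 : (((1 : ℤ) : ℂ) * Complex.I * F₂ 0 + 2 * F₁ 0).re = 0 := by simp [hF₂0, hF₁0]
    have hpos := pos_of_oscillator hh hk h0 k0 fun x hx => by linarith [(hb x hx).1]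
    have hle := le_of_oscillator hh hk h0 k0 hpos (A := 4 * 8 ^ n) (m := 3 * n + 2)
      fun x hx => by linarith [(hb x hx).2]
    have hg : ∀ x, HasDerivAt (fun x => (F₃ x).re) (2 * (F₂ x).re) x := fun x => by
      refine (hasDerivAt_re (hF₃' x)).congr_deriv ?_
      simp
    refine ⟨F₃, hF₃.mono (by rw [pow_succ]; linarith), fun x hx => ⟨?_, ?_⟩⟩
    · exact pos_of_hasDerivAt_pos hg (by simp [hF₃0])
        (fun y hy => by linarith [hpos y ⟨hy.1, hy.2.le.trans hx.2⟩]) hx.1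
    · refine le_of_hasDerivAt_le hg (hasDerivAt_pow_div_factorial (8 ^ (n + 1)) (3 * n + 4))
        (by simp [hF₃0]) (by simp) (fun y hy => ?_) hx.1
      have := hle y ⟨hy.1, hy.2.le.trans hx.2⟩
      rw [pow_succ]
      linarith

theorem exists_int_re_I_pow (m : ℕ) : ∃ ε : ℤ, |(ε : ℝ)| ≤ 1 ∧ ((Complex.I ^ m).re : ℝ) = ε := by
  have h := Nat.div_add_mod m 4
  rw [← h, pow_add, pow_mul, Complex.I_pow_four, one_pow, one_mul]
  have : m % 4 < 4 := Nat.mod_lt _ (by norm_num)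
  interval_cases m % 4
  · exact ⟨1, by simp⟩
  · exact ⟨0, by simp⟩
  · exact ⟨-1, by simp⟩
  · exact ⟨0, by simp [pow_succ]⟩

theorem exists_exp_mul_pi_eq_I_pow {ω : ℤ} (hω : |ω| ≤ 1) :
    ∃ m : ℕ, Complex.exp (ω * Real.pi * Complex.I) = Complex.I ^ m := by
  rw [abs_le] at hω
  obtain rfl | rfl | rfl : ω = -1 ∨ ω = 0 ∨ ω = 1 := by omega
  · exact ⟨2, by simp [Complex.exp_neg]⟩
  · exact ⟨0, by simp⟩
  · exact ⟨2, by simp⟩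

theorem exists_pow_eq_add_mul_sqrt_two (r s : ℤ) (j : ℕ) :
    ∃ u v : ℤ, (r + s * √2 : ℝ) ^ j = u + v * √2 ∧ (r - s * √2 : ℝ) ^ j = u - v * √2 := by
  have h2 : √2 * √2 = 2 := Real.mul_self_sqrt (by norm_num)
  induction j with
  | zero => exact ⟨1, 0, by simp⟩
  | succ j ih =>
    obtain ⟨u, v, h, h'⟩ := ih
    refine ⟨u * r + 2 * v * s, u * s + v * r, ?_, ?_⟩
    · rw [pow_succ, h]; push_cast; linear_combination (v * s : ℝ) * h2
    · rw [pow_succ, h']; push_cast; linear_combination (v * s : ℝ) * h2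

theorem IntExpPoly.exists_eval_pi {n : ℕ} {C : ℝ} {f : ℝ → ℂ}
    (h : IntExpPoly (fun _ => n) C f) {d : ℕ} {r s : ℤ} (hπ : d * Real.pi = r + s * √2)
    {Y : ℝ} (hY : |r - s * √2| ≤ Y) (hdY : d ≤ Y) :
    ∃ u v : ℤ, n.factorial * d ^ n * (f Real.pi).re = u + v * √2 ∧
      |u - v * √2| ≤ n.factorial * Y ^ n * C := by
  have hY0 : 0 ≤ Y := (abs_nonneg _).trans hY
  induction h with
  | basis k j ω hω hj =>
    obtain ⟨m, hm⟩ := exists_exp_mul_pi_eq_I_pow hω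
    obtain ⟨ε, hε, hre⟩ := exists_int_re_I_pow (k + m)
    obtain ⟨u, v, hu, hv⟩ := exists_pow_eq_add_mul_sqrt_two r s j
    obtain ⟨i, rfl⟩ := Nat.exists_eq_add_of_le hj
    obtain ⟨q, hq⟩ := Nat.factorial_dvd_factorial hj
    have hj0 : (j.factorial : ℝ) ≠ 0 := by positivity
    have hqle : (q : ℝ) ≤ (j + i).factorial := by
      rw [hq]; exact_mod_cast Nat.le_mul_of_pos_left q j.factorial_pos
    refine ⟨ε * q * 2 ^ j * d ^ i * u, ε * q * 2 ^ j * d ^ i * v, ?_, ?_⟩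
    · have : (Complex.I ^ k * ((2 * (Real.pi : ℂ)) ^ j / (j.factorial : ℂ) *
          Complex.exp (ω * Real.pi * Complex.I))).re =
          ((2 * Real.pi) ^ j / j.factorial) * ε := by
        rw [hm, ← hre, pow_add, ← Complex.re_ofReal_mul]
        congr 1
        push_cast
        ring
      rw [this, hq]
      push_cast
      field_simp
      rw [← hπ] at hu
      linear_combination ((q : ℝ) * ε * 2 ^ j * d ^ i) * hu
    · have e : ((ε * q * 2 ^ j * d ^ i * u : ℤ) : ℝ) - ((ε * q * 2 ^ j * d ^ i * v : ℤ) : ℝ) * √2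
          = ε * (q * 2 ^ j * d ^ i * (r - s * √2) ^ j) := by
        rw [hv]; push_cast; ring
      rw [e, abs_mul, abs_mul, abs_pow, abs_of_nonneg (by positivity : (0 : ℝ) ≤ q * 2 ^ j * d ^ i)]
      calc _ ≤ 1 * ((j + i).factorial * 4 ^ j * Y ^ i * Y ^ j) := by gcongr; norm_num
        _ = _ := by rw [pow_add]; ring
  | add _ _ h₁ h₂ =>
    obtain ⟨u, v, h, hle⟩ := h₁
    obtain ⟨u', v', h', hle'⟩ := h₂
    refine ⟨u + u', v + v', ?_, ?_⟩
    · rw [Complex.add_re, mul_add, h, h']; push_cast; ring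
    · have := abs_add_le (u - v * √2) (u' - v' * √2)
      push_cast
      rw [show (u + u' : ℝ) - (v + v') * √2 = (u - v * √2) + (u' - v' * √2) by ring]
      linarith
  | mono _ hle h =>
    obtain ⟨u, v, h, h'⟩ := h
    exact ⟨u, v, h, h'.trans (by gcongr)⟩

theorem eq_zero_of_add_mul_sqrt_two_eq_zero {u v : ℤ} (h : (u + v * √2 : ℝ) = 0) :
    u = 0 ∧ v = 0 := by
  have hv : v = 0 := by
    by_contra hv
    refine irrational_sqrt_two ⟨-u / v, ?_⟩
    have : (v : ℝ) ≠ 0 := by exact_mod_cast hv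
    push_cast
    field_simp
    linarith
  subst hv
  exact ⟨by simpa using h, rfl⟩

theorem one_le_abs_mul_conj_sqrt_two {u v : ℤ} (h : (u + v * √2 : ℝ) ≠ 0) :
    1 ≤ |(u + v * √2) * (u - v * √2)| := by
  have h2 : √2 * √2 = 2 := Real.mul_self_sqrt (by norm_num)
  have e : ((u + v * √2) * (u - v * √2) : ℝ) = ((u * u - 2 * (v * v) : ℤ) : ℝ) := by
    push_cast; linear_combination (-(v * v) : ℝ) * h2
  rw [e, ← Int.cast_abs]
  have hne : u * u - 2 * (v * v) ≠ 0 := by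
    intro h0
    rw [h0, Int.cast_zero] at e
    have h1 := (mul_eq_zero.1 e).resolve_left h
    obtain ⟨rfl, hv⟩ := eq_zero_of_add_mul_sqrt_two_eq_zero (u := u) (v := -v)
      (by push_cast; linarith)
    obtain rfl := neg_eq_zero.1 hv
    simp at h
  exact_mod_cast Int.one_le_abs hne

theorem factorial_pow_three_le (n : ℕ) : n.factorial ^ 3 ≤ (3 * n + 2).factorial := by
  have h1 := Nat.factorial_mul_factorial_dvd_factorial_add n n
  have h2 := Nat.factorial_mul_factorial_dvd_factorial_add (n + n) n
  have h3 := Nat.le_of_dvd (Nat.factorial_pos _) ((Nat.mul_dvd_mul_right h1 n.factorial).trans h2)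
  calc n.factorial ^ 3 = n.factorial * n.factorial * n.factorial := by ring
    _ ≤ (n + n + n).factorial := h3
    _ ≤ _ := Nat.factorial_le (by omega)

theorem natCast_mul_pi_ne_add_mul_sqrt_two {d : ℕ} (hd : d ≠ 0) (r s : ℤ) :
    (d * Real.pi : ℝ) ≠ r + s * √2 := by
  intro hπ
  set Y : ℝ := max |(r - s * √2 : ℝ)| d
  have hY0 : 0 ≤ Y := (abs_nonneg _).trans (le_max_left _ _)
  have hd0 : (0 : ℝ) < d := by exact_mod_cast Nat.pos_of_ne_zero hd
  have hπ0 := Real.pi_pos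
  set K : ℝ := d * Y * 8 * 512 * Real.pi ^ 3
  have hK0 : 0 ≤ K := by positivity
  have key : ∀ n : ℕ, 1 ≤ 2 * Real.pi ^ 2 * (K ^ n / n.factorial) := by
    intro n
    obtain ⟨f, hf, hb⟩ := exists_intExpPoly_pos_le n
    obtain ⟨hpos, hle⟩ := hb Real.pi ⟨Real.pi_pos, le_rfl⟩
    obtain ⟨u, v, hu, hv⟩ := hf.exists_eval_pi hπ (le_max_left _ _) (le_max_right _ _)
    have hn : (0 : ℝ) < n.factorial := by positivity
    have hA : 0 < n.factorial * (d : ℝ) ^ n * (f Real.pi).re := by positivity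
    have h1 := one_le_abs_mul_conj_sqrt_two (u := u) (v := v) (by rw [← hu]; exact hA.ne')
    rw [abs_mul, ← hu, abs_of_pos hA] at h1
    have hfac : ((n.factorial : ℝ)) ^ 3 ≤ (3 * n + 2).factorial := by
      exact_mod_cast factorial_pow_three_le n
    calc (1 : ℝ) ≤ _ := h1
      _ ≤ (n.factorial * (d : ℝ) ^ n * (8 ^ n * (Real.pi ^ (3 * n + 2) / n.factorial ^ 3))) *
          (n.factorial * Y ^ n * (2 * 512 ^ n)) := by
        gcongr
        refine hle.trans ?_
        gcongr
      _ = _ := by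
        simp only [K, mul_pow]
        rw [pow_add, pow_mul]
        field_simp
  have hlim := (FloorSemiring.tendsto_pow_div_factorial_atTop K).const_mul (2 * Real.pi ^ 2)
  have := ge_of_tendsto' hlim key
  norm_num at this

theorem dense_linearOrbit {a : ℝ} (ha : Irrational a)
    (p : AddCircle (1 : ℝ) × AddCircle (1 : ℝ)) : Dense (linearOrbit a p) := by
  rintro ⟨x, y⟩
  obtain ⟨t, ht⟩ := QuotientAddGroup.mk_surjective (x - p.1)
  have hd : DenseRange (· • (a : AddCircle (1 : ℝ)) : ℤ → AddCircle (1 : ℝ)) :=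
    AddCircle.denseRange_zsmul_coe_iff.2 (by simpa using ha)
  have hmaps : MapsTo
      (fun z : AddCircle (1 : ℝ) => (x, p.2 + ((a * t : ℝ) : AddCircle (1 : ℝ)) + z))
      (range (· • (a : AddCircle (1 : ℝ)) : ℤ → AddCircle (1 : ℝ))) (linearOrbit a p) := by
    rintro _ ⟨n, rfl⟩
    refine ⟨t + n, ?_⟩
    have h1 : ((t + n : ℝ) : AddCircle (1 : ℝ)) = x - p.1 := by
      have hn : ((n : ℝ) : AddCircle (1 : ℝ)) = 0 :=
        (AddCircle.coe_eq_zero_iff 1).2 ⟨n, by simp⟩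
      rw [← ht, AddCircle.coe_add, hn, add_zero]
    rw [h1, mul_add, AddCircle.coe_add, mul_comm a n, ← zsmul_eq_mul, AddCircle.coe_zsmul]
    simp [add_assoc]
  have := map_mem_closure (by fun_prop)
    (hd (y - (p.2 + ((a * t : ℝ) : AddCircle (1 : ℝ))))) hmaps
  simpa using this

theorem eq_of_continuous_of_countable {X : Type*} [TopologicalSpace X] [PreconnectedSpace X]
    {f : X → ℝ} (hf : Continuous f) {S : Set ℝ} (hS : S.Countable) (hfS : ∀ x, f x ∈ S)
    (x y : X) : f x = f y := by
  have hpre : (range f).OrdConnected := (isPreconnected_range hf).ordConnected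
  have hc : (range f).Countable := hS.mono (range_subset_iff.2 hfS)
  have key : ∀ a ∈ range f, ∀ b ∈ range f, ¬ a < b := fun a ha b hb hab =>
    (Cardinal.Real.Icc_countable_iff.1 (hc.mono (hpre.out ha hb))).not_gt hab
  exact le_antisymm (not_lt.1 (key _ ⟨y, rfl⟩ _ ⟨x, rfl⟩)) (not_lt.1 (key _ ⟨x, rfl⟩ _ ⟨y, rfl⟩))

theorem exists_continuous_real_lift {f : ℝ × ℝ → AddCircle (1 : ℝ)} (hf : Continuous f) :
    ∃ F : ℝ × ℝ → ℝ, Continuous F ∧ ∀ x, (F x : AddCircle (1 : ℝ)) = f x := by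
  obtain ⟨e, he⟩ := QuotientAddGroup.mk_surjective (f 0)
  obtain ⟨F, ⟨-, hF⟩, -⟩ := (AddCircle.isCoveringMap_coe (1 : ℝ)).existsUnique_continuousMap_lifts
    ⟨f, hf⟩ 0 e he
  exact ⟨F, F.continuous, fun x => congrFun hF x⟩

theorem exists_int_eq_add_of_coe_eq {x y : ℝ}
    (h : (x : AddCircle (1 : ℝ)) = (y : AddCircle (1 : ℝ))) : ∃ n : ℤ, x = y + n := by
  obtain ⟨n, hn⟩ := (AddCircle.coe_eq_zero_iff (1 : ℝ)).1
    (show ((x - y : ℝ) : AddCircle (1 : ℝ)) = 0 by rw [AddCircle.coe_sub, h, sub_self])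
  exact ⟨n, by simp at hn; linarith⟩

/-- A real lift of a circle-valued function of period `v` changes by a constant integer under
translation by `v`. -/
theorem exists_int_translation {F : ℝ × ℝ → ℝ} (hF : Continuous F) (v : ℝ × ℝ)
    (hper : ∀ x, (F (x + v) : AddCircle (1 : ℝ)) = F x) : ∃ n : ℤ, ∀ x, F (x + v) = F x + n := by
  have hcont : Continuous fun x => F (x + v) - F x := by fun_prop
  have hint : ∀ x, F (x + v) - F x ∈ range ((↑) : ℤ → ℝ) := fun x => by
    obtain ⟨n, hn⟩ := exists_int_eq_add_of_coe_eq (hper x)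
    exact ⟨n, by rw [hn]; ring⟩
  obtain ⟨n, hn⟩ := hint 0
  refine ⟨n, fun x => ?_⟩
  have := eq_of_continuous_of_countable hcont (countable_range _) hint x 0
  rw [hn, ← this]; ring

/-- A continuous function of period `1` cannot grow linearly along an arithmetic progression. -/
theorem eq_zero_of_periodic_of_translation {φ : ℝ → ℝ} (hφ : Continuous φ)
    (hper : Function.Periodic φ 1) {α c : ℝ} (hα : ∀ u, φ (u + α) = φ u + c) : c = 0 := by
  obtain ⟨M, hM⟩ := (isCompact_Icc (a := (0 : ℝ)) (b := 1)).exists_bound_of_continuousOn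
    hφ.continuousOn
  have hbdd : ∀ u, |φ u| ≤ M := fun u => by
    rw [← hper.sub_zsmul_eq ⌊u⌋]
    refine hM _ ⟨?_, ?_⟩
    · simp
    · simpa using (Int.fract_lt_one u).le
  have hn : ∀ n : ℕ, φ (n * α) = φ 0 + n * c := by
    intro n
    induction n with
    | zero => simp
    | succ n ih =>
      push_cast
      rw [add_mul, one_mul, hα, ih]; ring
  by_contra hc
  obtain ⟨n, hlt⟩ := exists_nat_gt (2 * M / |c|)
  rw [div_lt_iff₀ (abs_pos.2 hc)] at hlt
  have h1 : |(n : ℝ) * c| ≤ 2 * M := by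
    rw [show (n : ℝ) * c = φ (n * α) - φ 0 by rw [hn]; ring]
    linarith [abs_sub (φ (n * α)) (φ 0), hbdd (n * α), hbdd 0]
  rw [abs_mul, Nat.abs_cast] at h1
  linarith

theorem eq_of_periodic_of_irrational {φ : ℝ → ℝ} (hφ : Continuous φ)
    (hper : Function.Periodic φ 1) {α : ℝ} (hα : Irrational α) (hperα : Function.Periodic φ α)
    (u : ℝ) : φ u = φ 0 := by
  have hd : Dense (AddSubgroup.closure {α, 1} : Set ℝ) :=
    dense_addSubgroupClosure_pair_iff.2 (by simpa using hα)
  have hP : ∀ s ∈ AddSubgroup.closure {α, 1}, Function.Periodic φ s := by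
    intro s hs
    induction hs using AddSubgroup.closure_induction with
    | mem x hx =>
      rcases hx with rfl | rfl
      exacts [hperα, hper]
    | zero => simp [Function.Periodic]
    | add x y _ _ hx hy => exact hx.add_period hy
    | neg x _ hx => exact hx.neg
  have : φ = fun _ => φ 0 := Continuous.ext_on hd hφ continuous_const
    fun s hs => by simpa using hP s hs 0
  exact congrFun this u

/-- A continuous surjection of the torus that maps lines of irrational slope `α` into lines of
slope `β` forces `β` to be the image of `α` under a nonzero integer matrix. -/
theorem exists_int_relation_of_mapsTo_linearOrbit
    {h : AddCircle (1 : ℝ) × AddCircle (1 : ℝ) → AddCircle (1 : ℝ) × AddCircle (1 : ℝ)}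
    (hcont : Continuous h) (hsurj : Function.Surjective h) {α β : ℝ} (hα : Irrational α)
    (hmaps : ∀ p, ∃ q, MapsTo h (linearOrbit α p) (linearOrbit β q)) :
    ∃ a b c d : ℤ, (c + d * α : ℝ) = β * (a + b * α) ∧ ¬ (a = 0 ∧ b = 0 ∧ c = 0 ∧ d = 0) := by
  set π₂ : ℝ × ℝ → AddCircle (1 : ℝ) × AddCircle (1 : ℝ) := fun x => (x.1, x.2) with hπ₂
  have hπc : Continuous π₂ :=
    ((AddCircle.continuous_mk' 1).comp continuous_fst).prodMk
      ((AddCircle.continuous_mk' 1).comp continuous_snd)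
  obtain ⟨F, hF, hFl⟩ := exists_continuous_real_lift (continuous_fst.comp (hcont.comp hπc))
  obtain ⟨G, hG, hGl⟩ := exists_continuous_real_lift (continuous_snd.comp (hcont.comp hπc))
  have hper₁ : ∀ x, π₂ (x + (1, 0)) = π₂ x := fun x => by
    simp [hπ₂]
  have hper₂ : ∀ x, π₂ (x + (0, 1)) = π₂ x := fun x => by
    simp [hπ₂]
  obtain ⟨a, ha⟩ := exists_int_translation hF (1, 0) fun x => by
    rw [hFl, hFl, Function.comp_apply, Function.comp_apply, Function.comp_apply, hper₁]; rfl
  obtain ⟨b, hb⟩ := exists_int_translation hF (0, 1) fun x => by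
    rw [hFl, hFl, Function.comp_apply, Function.comp_apply, Function.comp_apply, hper₂]; rfl
  obtain ⟨c, hc⟩ := exists_int_translation hG (1, 0) fun x => by
    rw [hGl, hGl, Function.comp_apply, Function.comp_apply, Function.comp_apply, hper₁]; rfl
  obtain ⟨d, hd⟩ := exists_int_translation hG (0, 1) fun x => by
    rw [hGl, hGl, Function.comp_apply, Function.comp_apply, Function.comp_apply, hper₂]; rfl
  have hline : ∀ x : ℝ × ℝ, G x - β * F x =
      G (0, x.2 - α * x.1) - β * F (0, x.2 - α * x.1) := by
    intro x
    obtain ⟨q, hq⟩ := hmaps (π₂ x)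
    obtain ⟨q₁, hq₁⟩ := QuotientAddGroup.mk_surjective q.1
    obtain ⟨q₂, hq₂⟩ := QuotientAddGroup.mk_surjective q.2
    set γ : ℝ → ℝ × ℝ := fun t => (x.1 + t, x.2 + α * t) with hγ
    have hγc : Continuous γ := by fun_prop
    have hval : ∀ t, G (γ t) - β * F (γ t) ∈
        range fun m : ℤ × ℤ => q₂ - β * q₁ + m.1 - β * m.2 := by
      intro t
      obtain ⟨τ, hτ⟩ := hq (show π₂ (γ t) ∈ linearOrbit α (π₂ x) from ⟨t, by simp [hπ₂, hγ]⟩)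
      obtain ⟨m, hm⟩ := exists_int_eq_add_of_coe_eq (x := F (γ t)) (y := q₁ + τ) (by
        rw [hFl, AddCircle.coe_add, show (q₁ : AddCircle (1 : ℝ)) = q.1 from hq₁]
        exact congrArg Prod.fst hτ)
      obtain ⟨n, hn⟩ := exists_int_eq_add_of_coe_eq (x := G (γ t)) (y := q₂ + β * τ) (by
        rw [hGl, AddCircle.coe_add, show (q₂ : AddCircle (1 : ℝ)) = q.2 from hq₂]
        exact congrArg Prod.snd hτ)
      exact ⟨(n, m), by dsimp only; rw [hm, hn]; ring⟩
    have := eq_of_continuous_of_countable (f := fun t => G (γ t) - β * F (γ t)) (by fun_prop)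
      (countable_range _) hval 0 (-x.1)
    simpa [hγ, ← sub_eq_add_neg] using this
  set ψ : ℝ → ℝ := fun u => G (0, u) - β * F (0, u) with hψ
  have hψc : Continuous ψ := by fun_prop
  have hψ1 : ∀ u, ψ (u + 1) = ψ u + (d - β * b) := fun u => by
    have h1 := hb (0, u)
    have h2 := hd (0, u)
    simp only [Prod.mk_add_mk, add_zero] at h1 h2
    simp only [hψ, h1, h2]; ring
  have hψα : ∀ u, ψ (u + α) = ψ u - (c - β * a) := fun u => by
    have h1 := ha (0, u + α)
    have h2 := hc (0, u + α)
    have h3 := hline (1, u + α)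
    simp only [Prod.mk_add_mk, add_zero, zero_add] at h1 h2
    simp only [h1, h2, mul_one, add_sub_cancel_right] at h3
    simp only [hψ]
    linarith
  have hrel := eq_zero_of_periodic_of_translation (φ := fun u => ψ u - (d - β * b) * u)
    (by fun_prop) (fun u => by simp only [hψ1]; ring)
    (α := α) (c := -(c - β * a) - (d - β * b) * α) (fun u => by simp only [hψα]; ring)
  refine ⟨a, b, c, d, by linarith, ?_⟩
  rintro ⟨rfl, rfl, rfl, rfl⟩
  have hconst : ∀ u, ψ u = ψ 0 := eq_of_periodic_of_irrational hψc
    (fun u => by simpa using hψ1 u) hα (fun u => by simpa using hψα u)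
  have hcount : (univ : Set ℝ).Countable := by
    refine (countable_range fun m : ℤ × ℤ => ψ 0 + β * m.1 + m.2).mono fun y _ => ?_
    obtain ⟨p, hp⟩ := hsurj (0, y)
    obtain ⟨x₁, hx₁⟩ := QuotientAddGroup.mk_surjective p.1
    obtain ⟨x₂, hx₂⟩ := QuotientAddGroup.mk_surjective p.2
    have hpx : π₂ (x₁, x₂) = p := Prod.ext hx₁ hx₂
    obtain ⟨m, hm⟩ := exists_int_eq_add_of_coe_eq (x := F (x₁, x₂)) (y := 0) (by
      rw [hFl, Function.comp_apply, Function.comp_apply, hpx, hp]; rfl)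
    obtain ⟨n, hn⟩ := exists_int_eq_add_of_coe_eq (x := y) (y := G (x₁, x₂)) (by
      rw [hGl, Function.comp_apply, Function.comp_apply, hpx, hp])
    have h1 := (hline (x₁, x₂)).trans (hconst _)
    refine ⟨(m, n), ?_⟩
    dsimp only
    rw [hn]
    rw [hm] at h1
    linarith
  exact Cardinal.not_countable_real hcount

theorem pi_mul_ne_of_int (a b c d : ℤ) (hne : ¬ (a = 0 ∧ b = 0 ∧ c = 0 ∧ d = 0)) :
    (c + d * √2 : ℝ) ≠ Real.pi * (a + b * √2) := by
  intro h
  have h2 : √2 * √2 = 2 := Real.mul_self_sqrt (by norm_num)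
  set N : ℤ := a * a - 2 * (b * b) with hN
  have hNπ : (N * Real.pi : ℝ) =
      ((c * a - 2 * (d * b) : ℤ) : ℝ) + ((d * a - c * b : ℤ) : ℝ) * √2 := by
    rw [hN]; push_cast
    linear_combination (-(a - b * √2) : ℝ) * h + (Real.pi * b * b - d * b : ℝ) * h2
  have hab : ¬ (a = 0 ∧ b = 0) := by
    rintro ⟨rfl, rfl⟩
    obtain ⟨rfl, rfl⟩ := eq_zero_of_add_mul_sqrt_two_eq_zero (u := c) (v := d) (by simpa using h)
    simp at hne
  have hN0 : N ≠ 0 := by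
    intro h0
    have hprod : ((a + b * √2) * (a - b * √2) : ℝ) = 0 := by
      have : ((a * a - 2 * (b * b) : ℤ) : ℝ) = 0 := by rw [← hN, h0, Int.cast_zero]
      push_cast at this
      linear_combination this - (b * b : ℝ) * h2
    rcases mul_eq_zero.1 hprod with h3 | h3
    · exact hab (eq_zero_of_add_mul_sqrt_two_eq_zero h3)
    · obtain ⟨ha, hb⟩ := eq_zero_of_add_mul_sqrt_two_eq_zero (u := a) (v := -b)
        (by push_cast; linarith)
      exact hab ⟨ha, neg_eq_zero.1 hb⟩
  have hsq : ((N.natAbs * N.natAbs : ℕ) : ℝ) = N * N := by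
    rw [← Int.cast_natCast, Int.natAbs_mul_self, Int.cast_mul]
  refine natCast_mul_pi_ne_add_mul_sqrt_two (mul_ne_zero (Int.natAbs_ne_zero.2 hN0)
    (Int.natAbs_ne_zero.2 hN0)) (N * (c * a - 2 * (d * b))) (N * (d * a - c * b)) ?_
  rw [hsq, mul_assoc, hNπ]
  push_cast
  ring

/-- On the torus `T² = (ℝ/ℤ) × (ℝ/ℤ)`, every orbit of the linear flow of slope `√2`
and every orbit of the linear flow of slope `π` is dense, yet there is no homeomorphism
of the torus mapping each orbit of the first flow onto an orbit of the second: the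
flows are not topologically equivalent. -/
theorem stmt19 :
    (∀ p : AddCircle (1 : ℝ) × AddCircle (1 : ℝ), Dense (linearOrbit (Real.sqrt 2) p)) ∧
    (∀ p : AddCircle (1 : ℝ) × AddCircle (1 : ℝ), Dense (linearOrbit Real.pi p)) ∧
    ¬ ∃ h : (AddCircle (1 : ℝ) × AddCircle (1 : ℝ)) ≃ₜ (AddCircle (1 : ℝ) × AddCircle (1 : ℝ)),
        ∀ p : AddCircle (1 : ℝ) × AddCircle (1 : ℝ),
          ∃ q : AddCircle (1 : ℝ) × AddCircle (1 : ℝ),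
            h '' linearOrbit (Real.sqrt 2) p = linearOrbit Real.pi q := by
  refine ⟨dense_linearOrbit irrational_sqrt_two, dense_linearOrbit irrational_pi, ?_⟩
  rintro ⟨h, hh⟩
  obtain ⟨a, b, c, d, hrel, hne⟩ := exists_int_relation_of_mapsTo_linearOrbit h.continuous
    h.surjective irrational_sqrt_two fun p => by
      obtain ⟨q, hq⟩ := hh p
      exact ⟨q, mapsTo_iff_image_subset.2 hq.subset⟩
  exact pi_mul_ne_of_int a b c d hne hrel
end
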